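/- For every n-vertex connected Eulerian digraph G with n > 1, the power G^k with k = ceil((1/2) * sqrt(n) * (log_2 n)^2) is Hamiltonian. -/

import Mathlib

open scoped Classical

variable {V : Type*}

/-- Outdegree of `v` in the digraph with arc set `A`. -/
noncomputable def outdeg (A : Finset (V × V)) (v : V) : ℕ :=
  (A.filter (fun a => a.1 = v)).card

/-- Indegree of `v` in the digraph with arc set `A`. -/
noncomputable def indeg (A : Finset (V × V)) (v : V) : ℕ :=
  (A.filter (fun a => a.2 = v)).card

/-- `p_#(G) = (1/2) ∑_v |d⁺(v) - d⁻(v)|`. -/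
noncomputable def pSharp [Fintype V] (A : Finset (V × V)) : ℕ :=
  (∑ v, ((outdeg A v : ℤ) - (indeg A v : ℤ)).natAbs) / 2

/-- A (simple) directed path, given as its list of vertices. -/
def IsDipath (A : Finset (V × V)) (l : List V) : Prop :=
  l ≠ [] ∧ l.Nodup ∧ l.Chain' (fun u v => (u, v) ∈ A)

/-- The arc set of a directed path given by its vertex list. -/
noncomputable def pathArcs (l : List V) : Finset (V × V) :=
  (l.zip l.tail).toFinset

/-- A (simple) directed cycle, given as its list of vertices (the closing
arc from the last vertex back to the first is implicit). -/
def IsDicycle (A : Finset (V × V)) (l : List V) : Prop :=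
  2 ≤ l.length ∧ l.Nodup ∧ (l ++ l.take 1).Chain' (fun u v => (u, v) ∈ A)

/-- The arc set of a directed cycle given by its vertex list. -/
noncomputable def cycleArcs (l : List V) : Finset (V × V) :=
  pathArcs (l ++ l.take 1)

/-- A digraph is loopless (simple). -/
def Loopless (A : Finset (V × V)) : Prop := ∀ a ∈ A, a.1 ≠ a.2

/-- A digraph is acyclic if it contains no directed cycle. -/
def Acyclic (A : Finset (V × V)) : Prop := ∀ l : List V, ¬ IsDicycle A l

/-- Strong connectivity: every vertex reaches every other by a directed walk. -/
def StrongConn (A : Finset (V × V)) : Prop :=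
  ∀ u v : V, Relation.ReflTransGen (fun x y => (x, y) ∈ A) u v

/-- A connected Eulerian digraph: strongly connected with balanced degrees. -/
def ConnEuler [Fintype V] (A : Finset (V × V)) : Prop :=
  StrongConn A ∧ ∀ v : V, outdeg A v = indeg A v

/-- Minimally Eulerian: connected Eulerian, and removing the arcs of any
directed cycle disconnects the digraph. -/
def MinEuler [Fintype V] (A : Finset (V × V)) : Prop :=
  ConnEuler A ∧ ∀ l : List V, IsDicycle A l → ¬ StrongConn (A \ cycleArcs l)

/-- A directed path from `u` to `v`. -/
def IsDipathFrom (A : Finset (V × V)) (u v : V) (l : List V) : Prop :=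
  IsDipath A l ∧ l.head? = some u ∧ l.getLast? = some v

/-- The adjacency relation of the `k`-th power: an arc `u → v` whenever
there is a directed path of length at most `k` from `u` to `v`. -/
def powRel (A : Finset (V × V)) (k : ℕ) (u v : V) : Prop :=
  u ≠ v ∧ ∃ l : List V, IsDipathFrom A u v l ∧ l.length ≤ k + 1

/-- Hamiltonicity of (the digraph given by) a relation `R`. -/
def IsHamiltonian (R : V → V → Prop) : Prop :=
  ∃ l : List V, l.Nodup ∧ (∀ v : V, v ∈ l) ∧ 2 ≤ l.length ∧
    (l ++ l.take 1).Chain' R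

/-- `w 0, …, w m` is a directed walk in the digraph with arc set `A`. -/
def IsWalk (A : Finset (V × V)) (w : ℕ → V) (m : ℕ) : Prop :=
  ∀ i < m, (w i, w (i + 1)) ∈ A

/-- A walk without repeated arcs. -/
def IsTrail (A : Finset (V × V)) (w : ℕ → V) (m : ℕ) : Prop :=
  IsWalk A w m ∧ ∀ i < m, ∀ j < m, w i = w j → w (i + 1) = w (j + 1) → i = j

section Walks

variable {A : Finset (V × V)} {w : ℕ → V} {m : ℕ}

theorem IsWalk.snoc (h : IsWalk A w m) {v : V} (hv : (w m, v) ∈ A) :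
    IsWalk A (fun i => if i ≤ m then w i else v) (m + 1) := by
  intro i hi
  rcases Nat.lt_succ_iff_lt_or_eq.1 hi with hi | rfl
  · simpa [hi.le, Nat.succ_le_of_lt hi] using h i hi
  · simpa using hv

theorem exists_isWalk_of_reflTransGen {u v : V}
    (h : Relation.ReflTransGen (fun x y => (x, y) ∈ A) u v) :
    ∃ w m, IsWalk A w m ∧ w 0 = u ∧ w m = v := by
  induction h with
  | refl => exact ⟨fun _ => u, 0, fun i hi => absurd hi (Nat.not_lt_zero i), rfl, rfl⟩
  | @tail b c _ hbc ih =>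
    obtain ⟨w, m, hw, h0, rfl⟩ := ih
    exact ⟨_, m + 1, hw.snoc hbc, by simpa using h0, by simp⟩

/-- A shortest walk is a path. -/
theorem IsWalk.exists_isDipathFrom (h : IsWalk A w m) :
    ∃ l, IsDipathFrom A (w 0) (w m) l ∧ l.length ≤ m + 1 := by
  induction m using Nat.strong_induction_on generalizing w with
  | _ m ih =>
    by_cases hinj : ∀ i ≤ m, ∀ j ≤ m, w i = w j → i = j
    · refine ⟨(List.range (m + 1)).map w, ⟨⟨by simp, ?_, ?_⟩, ?_, ?_⟩, by simp⟩
      · refine List.Nodup.map_on ?_ List.nodup_range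
        intro i hi j hj
        simp only [List.mem_range] at hi hj
        exact hinj i (by omega) j (by omega)
      · refine (List.isChain_map w).2 ?_
        rw [List.isChain_range_succ]
        exact h
      · simp [List.range_succ_eq_map]
      · simp [List.getLast?_range]
    · push Not at hinj
      obtain ⟨i, hi, j, hj, hij, hne⟩ := hinj
      wlog hlt : i < j generalizing i j
      · exact this j hj i hi hij.symm hne.symm (by omega)
      have key : IsWalk A (fun x => if x ≤ i then w x else w (x + (j - i))) (m - (j - i)) := by
        intro x hx
        rcases lt_trichotomy x i with hxi | rfl | hxi
        · simpa [hxi.le, Nat.succ_le_of_lt hxi] using h x (by omega)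
        · have := h j (by omega)
          rw [← hij] at this
          simpa [show x + 1 + (j - x) = j + 1 by omega] using this
        · have := h (x + (j - i)) (by omega)
          simpa [show ¬ x ≤ i by omega, show ¬ x + 1 ≤ i by omega,
            show x + 1 + (j - i) = x + (j - i) + 1 by omega] using this
      obtain ⟨l, hl, hlen⟩ := ih _ (by omega) key
      refine ⟨l, ?_, by omega⟩
      by_cases hjm : j = m
      · subst hjm
        simpa [show j - (j - i) = i by omega, hij] using hl
      · simpa [show ¬ m - (j - i) ≤ i by omega, show m - (j - i) + (j - i) = m by omega] using hl

theorem IsWalk.powRel {k : ℕ} (h : IsWalk A w m) (hmk : m ≤ k) (hne : w 0 ≠ w m) :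
    powRel A k (w 0) (w m) := by
  obtain ⟨l, hl, hlen⟩ := h.exists_isDipathFrom
  exact ⟨hne, l, hl, by omega⟩

theorem powRel_of_card_le [Fintype V] (h : StrongConn A) {k : ℕ} (hk : Fintype.card V ≤ k + 1)
    {u v : V} (huv : u ≠ v) : powRel A k u v := by
  obtain ⟨w, m, hw, rfl, rfl⟩ := exists_isWalk_of_reflTransGen (h u v)
  obtain ⟨l, hl, -⟩ := hw.exists_isDipathFrom
  exact ⟨huv, l, hl, hl.1.2.1.length_le_card.trans hk⟩

end Walks

section Balanced

theorem exists_balanced_subset {F : Finset (V × V)} {R : Finset V} (hR : R.Nonempty)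
    (h : ∀ x ∈ R, ∃ y ∈ R, (x, y) ∈ F) :
    ∃ C ⊆ F, C.Nonempty ∧ ∀ v, outdeg C v = indeg C v := by
  have hg : ∃ g : V → V, ∀ x ∈ R, g x ∈ R ∧ (x, g x) ∈ F := by
    choose! g h1 h2 using h
    exact ⟨g, fun x hx => ⟨h1 x hx, h2 x hx⟩⟩
  obtain ⟨g, hg⟩ := hg
  clear h
  induction R using Finset.strongInduction with
  | _ R ih =>
    have hsub : R.image g ⊆ R := Finset.image_subset_iff.2 fun x hx => (hg x hx).1
    by_cases himg : R.image g = R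
    · have hinj : Set.InjOn g R := Finset.card_image_iff.1 (by rw [himg])
      have hpair : Function.Injective fun x => (x, g x) := fun x y hxy => (Prod.ext_iff.1 hxy).1
      refine ⟨R.image fun x => (x, g x), Finset.image_subset_iff.2 fun x hx => (hg x hx).2,
        hR.image _, fun v => ?_⟩
      rw [outdeg, indeg, Finset.filter_image, Finset.filter_image,
        Finset.card_image_of_injective _ hpair, Finset.card_image_of_injective _ hpair]
      conv_lhs => rw [← himg, Finset.filter_image]
      exact Finset.card_image_of_injOn (hinj.mono (Finset.coe_subset.2 (Finset.filter_subset _ _)))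
    · refine ih _ (hsub.ssubset_of_ne himg) (hR.image g) fun x hx => ?_
      exact ⟨Finset.mem_image_of_mem g (hsub hx), (hg x (hsub hx)).2⟩

variable [Fintype V] {A : Finset (V × V)}

theorem sum_arcs_fst (A : Finset (V × V)) (f : V → ℤ) :
    ∑ a ∈ A, f a.1 = ∑ v, (outdeg A v : ℤ) * f v := by
  rw [← Finset.sum_fiberwise A (fun a => a.1)]
  refine Finset.sum_congr rfl fun v _ => ?_
  rw [Finset.sum_congr rfl (g := fun _ => f v)
    (fun a ha => by rw [(Finset.mem_filter.1 ha).2])]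
  simp [outdeg]

theorem sum_arcs_snd (A : Finset (V × V)) (f : V → ℤ) :
    ∑ a ∈ A, f a.2 = ∑ v, (indeg A v : ℤ) * f v := by
  rw [← Finset.sum_fiberwise A (fun a => a.2)]
  refine Finset.sum_congr rfl fun v _ => ?_
  rw [Finset.sum_congr rfl (g := fun _ => f v)
    (fun a ha => by rw [(Finset.mem_filter.1 ha).2])]
  simp [indeg]

theorem sum_arcs_eq_of_balanced (h : ∀ v, outdeg A v = indeg A v) (f : V → ℤ) :
    ∑ a ∈ A, f a.1 = ∑ a ∈ A, f a.2 := by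
  rw [sum_arcs_fst, sum_arcs_snd]
  simp [h]

/-- In a balanced digraph, a vertex reaching every vertex is reached by every vertex. -/
theorem strongConn_of_balanced (h : ∀ v, outdeg A v = indeg A v) (r : V)
    (hr : ∀ v, Relation.ReflTransGen (fun x y => (x, y) ∈ A) r v) : StrongConn A := by
  suffices H : ∀ v, Relation.ReflTransGen (fun x y => (x, y) ∈ A) v r from
    fun u v => (H u).trans (hr v)
  intro v
  set R : V → Prop := fun x => Relation.ReflTransGen (fun x y => (x, y) ∈ A) v x with hR
  have hstep : ∀ a ∈ A, R a.1 → R a.2 := fun a ha h1 => h1.tail ha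
  have hback : ∀ a ∈ A, R a.2 → R a.1 := by
    have hsum := sum_arcs_eq_of_balanced h (fun x => if R x then 1 else 0)
    have hle : ∀ a ∈ A, (if R a.1 then (1 : ℤ) else 0) ≤ if R a.2 then 1 else 0 := by
      intro a ha
      have := hstep a ha
      split_ifs <;> simp_all
    intro a ha h2
    have := (Finset.sum_eq_sum_iff_of_le hle).1 hsum a ha
    by_contra h1
    simp [h1, h2] at this
  have hall : ∀ {x}, Relation.ReflTransGen (fun x y => (x, y) ∈ A) x v → R x := by
    intro x hx
    induction hx using Relation.ReflTransGen.head_induction_on with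
    | refl => exact .refl
    | head hab _ ih => exact hback _ hab ih
  exact hall (hr v)

end Balanced

section Trails

variable {A : Finset (V × V)} {w : ℕ → V} {m : ℕ}

theorem IsTrail.snoc (h : IsTrail A w m) {v : V} (hv : (w m, v) ∈ A)
    (hnew : ∀ i < m, w i = w m → w (i + 1) ≠ v) :
    IsTrail A (fun i => if i ≤ m then w i else v) (m + 1) := by
  refine ⟨h.1.snoc hv, fun i hi j hj hij hij' => ?_⟩
  rcases Nat.lt_succ_iff_lt_or_eq.1 hi with hi | rfl <;>
  rcases Nat.lt_succ_iff_lt_or_eq.1 hj with hj | rfl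
  · simp only [hi.le, hj.le, Nat.succ_le_of_lt hi, Nat.succ_le_of_lt hj, if_true] at hij hij'
    exact h.2 i hi j hj hij hij'
  · simp [hi.le, Nat.succ_le_of_lt hi] at hij hij'
    exact absurd hij' (hnew i hi hij)
  · simp [hj.le, Nat.succ_le_of_lt hj] at hij hij'
    exact absurd hij'.symm (hnew j hj hij.symm)
  · rfl

theorem IsTrail.le_card (h : IsTrail A w m) : m ≤ A.card := by
  have := Finset.card_le_card_of_injOn (s := Finset.range m) (t := A)
    (fun i => (w i, w (i + 1))) (fun i hi => h.1 i (by simpa using hi)) (by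
      intro i hi j hj hij
      simp only [Prod.mk.injEq] at hij
      exact h.2 i (by simpa using hi) j (by simpa using hj) hij.1 hij.2)
  simpa using this

theorem IsTrail.rotate (h : IsTrail A w m) (hm : w m = w 0) {j : ℕ} (hj : j < m) :
    IsTrail A (fun i => w ((i + j) % m)) m ∧ ∀ i < m, ∃ i' < m,
      w ((i + j) % m) = w i' ∧ w ((i + 1 + j) % m) = w (i' + 1) := by
  have key : ∀ i, w ((i + 1 + j) % m) = w ((i + j) % m + 1) := by
    intro i
    have hlt : (i + j) % m < m := Nat.mod_lt _ (by omega)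
    rw [show i + 1 + j = i + j + 1 by omega, ← Nat.mod_add_mod]
    rcases Nat.lt_or_ge ((i + j) % m + 1) m with h1 | h1
    · rw [Nat.mod_eq_of_lt h1]
    · rw [show (i + j) % m + 1 = m by omega, Nat.mod_self, hm]
  have hlt : ∀ i, (i + j) % m < m := fun i => Nat.mod_lt _ (by omega)
  refine ⟨⟨fun i hi => ?_, fun a ha b hb hab hab' => ?_⟩, fun i hi => ⟨_, hlt i, rfl, key i⟩⟩
  · simpa [key] using h.1 _ (hlt i)
  · simp only [key] at hab hab'
    have : a + j ≡ b + j [MOD m] := h.2 _ (hlt a) _ (hlt b) hab hab'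
    have := Nat.ModEq.add_right_cancel' j this
    exact Nat.ModEq.eq_of_lt_of_lt this ha hb

theorem card_filter_walk_telescope (w : ℕ → V) (m : ℕ) (v : V) :
    ((Finset.range m).filter fun i => w (i + 1) = v).card + (if w 0 = v then 1 else 0) =
      ((Finset.range m).filter fun i => w i = v).card + if w m = v then 1 else 0 := by
  simp only [Finset.card_filter]
  rw [← Finset.sum_range_succ (fun i => if w i = v then 1 else 0), Finset.sum_range_succ']

/-- A trail in a balanced digraph that cannot be extended is closed. -/
theorem IsTrail.closed_of_maximal [Fintype V] (hA : ∀ v, outdeg A v = indeg A v)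
    (h : IsTrail A w m) (hmax : ∀ v, (w m, v) ∈ A → ∃ i < m, w i = w m ∧ w (i + 1) = v) :
    w m = w 0 := by
  by_contra hne
  have hout : outdeg A (w m) ≤ ((Finset.range m).filter fun i => w i = w m).card := by
    refine Finset.card_le_card_of_surjOn (fun i => (w i, w (i + 1))) ?_
    rintro ⟨x, y⟩ hxy
    simp only [Finset.coe_filter, Set.mem_ofPred_eq] at hxy
    obtain ⟨hxy, rfl⟩ := hxy
    obtain ⟨i, hi, h1, h2⟩ := hmax y hxy
    exact ⟨i, by simp [hi, h1], by simp [h1, h2]⟩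
  have hin : ((Finset.range m).filter fun i => w (i + 1) = w m).card ≤ indeg A (w m) := by
    refine Finset.card_le_card_of_injOn (fun i => (w i, w (i + 1))) ?_ ?_
    · intro i hi
      simp only [Finset.coe_filter, Finset.mem_range, Set.mem_ofPred_eq] at hi ⊢
      exact ⟨h.1 i hi.1, hi.2⟩
    · intro i hi j hj hij
      simp only [Finset.coe_filter, Finset.mem_range, Set.mem_ofPred_eq, Prod.mk.injEq]
        at hi hj hij
      exact h.2 i hi.1 j hj.1 hij.1 hij.2
  have htel := card_filter_walk_telescope w m (w m)
  rw [if_neg (Ne.symm hne), if_pos rfl] at htel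
  have := hA (w m)
  omega

/-- A connected Eulerian digraph has a closed trail through all vertices. -/
theorem ConnEuler.exists_closed_trail [Fintype V] (hV : 1 < Fintype.card V) (h : ConnEuler A) :
    ∃ w m, IsTrail A w m ∧ w m = w 0 ∧ ∀ v, ∃ i < m, w i = v := by
  have : Nonempty V := Fintype.card_pos_iff.1 (by omega)
  obtain ⟨m, ⟨w, hw⟩, hmax⟩ : ∃ m, (∃ w, IsTrail A w m) ∧ ∀ w', ¬ IsTrail A w' (m + 1) := by
    by_contra! hcon
    have : ∀ m, ∃ w, IsTrail A w m := fun m => by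
      induction m with
      | zero => exact ⟨fun _ => Classical.arbitrary V, by simp [IsTrail, IsWalk]⟩
      | succ m ih => exact hcon m ih
    obtain ⟨w, hw⟩ := this (A.card + 1)
    exact absurd hw.le_card (by omega)
  have hext : ∀ w', IsTrail A w' m →
      ∀ v, (w' m, v) ∈ A → ∃ i < m, w' i = w' m ∧ w' (i + 1) = v := by
    intro w' hw' v hv
    by_contra! hcon
    exact hmax _ (hw'.snoc hv hcon)
  have hclosed := hw.closed_of_maximal h.2 (hext w hw)
  have hvisit : ∀ v, ∃ i ≤ m, w i = v := by
    intro v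
    induction h.1 (w 0) v with
    | refl => exact ⟨0, by omega, rfl⟩
    | @tail b c _ hbc ih =>
      obtain ⟨j, hj, rfl⟩ := ih
      rcases hj.lt_or_eq with hj | rfl
      · obtain ⟨hrot, hrot'⟩ := hw.rotate hclosed hj
        obtain ⟨i, hi, h1, h2⟩ := hext _ hrot c (by simpa [Nat.mod_eq_of_lt hj] using hbc)
        obtain ⟨i', hi', -, h4⟩ := hrot' i hi
        exact ⟨i' + 1, by omega, h4.symm.trans h2⟩
      · obtain ⟨i, hi, h1, h2⟩ := hext _ hw c hbc
        exact ⟨i + 1, by omega, h2⟩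
  have hm : 0 < m := by
    by_contra hm0
    obtain ⟨x, y, hxy⟩ := Fintype.one_lt_card_iff.1 hV
    obtain ⟨i, hi, rfl⟩ := hvisit x
    obtain ⟨j, hj, rfl⟩ := hvisit y
    exact hxy (by rw [show i = j by omega])
  refine ⟨w, m, hw, hclosed, fun v => ?_⟩
  obtain ⟨i, hi, rfl⟩ := hvisit v
  rcases hi.lt_or_eq with hi | rfl
  · exact ⟨i, hi, rfl⟩
  · exact ⟨0, hm, hclosed.symm⟩

end Trails

section Density

variable [Fintype V] {A : Finset (V × V)}

/-- A strongly connected digraph has a spanning out-arborescence from every vertex. -/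
theorem StrongConn.exists_arborescence (h : StrongConn A) (r : V) :
    ∃ T ⊆ A, (∀ a ∈ T, ∀ b ∈ T, a.2 = b.2 → a = b) ∧
      ∀ v, Relation.ReflTransGen (fun x y => (x, y) ∈ T) r v := by
  have hwalk : ∀ v, ∃ m, ∃ w, IsWalk A w m ∧ w 0 = r ∧ w m = v := fun v => by
    obtain ⟨w, m, hw⟩ := exists_isWalk_of_reflTransGen (h r v)
    exact ⟨m, w, hw⟩
  set d : V → ℕ := fun v => Nat.find (hwalk v) with hd
  have hparent : ∀ v, v ≠ r → ∃ u, (u, v) ∈ A ∧ d u < d v := by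
    intro v hv
    obtain ⟨w, hw, h0, hm⟩ := Nat.find_spec (hwalk v)
    have hpos : d v ≠ 0 := fun h0' => hv (hm.symm.trans ((congrArg w h0').trans h0))
    obtain ⟨e, he⟩ := Nat.exists_eq_succ_of_ne_zero hpos
    change IsWalk A w (d v) at hw
    change w (d v) = v at hm
    rw [he] at hw hm
    refine ⟨w e, ?_, ?_⟩
    · rw [← hm]
      exact hw e (Nat.lt_succ_self e)
    · have : d (w e) ≤ e :=
        Nat.find_min' (hwalk (w e)) ⟨w, fun i hi => hw i (by omega), h0, rfl⟩
      omega
  choose! p hpA hpd using hparent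
  refine ⟨(Finset.univ.erase r).image fun v => (p v, v), ?_, ?_, ?_⟩
  · exact Finset.image_subset_iff.2 fun v hv => hpA v (Finset.ne_of_mem_erase hv)
  · simp only [Finset.mem_image]
    rintro a ⟨v, -, rfl⟩ b ⟨v', -, rfl⟩ hab
    obtain rfl : v = v' := hab
    rfl
  · intro v
    induction hn : d v using Nat.strong_induction_on generalizing v with
    | _ n ih =>
      by_cases hv : v = r
      · rw [hv]
      · refine (ih _ (hn ▸ hpd v hv) (p v) rfl).tail ?_
        exact Finset.mem_image.2 ⟨v, by simp [hv], rfl⟩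

/-- Outside a spanning arborescence, a connected Eulerian digraph with fewest arcs contains no
nonempty balanced digraph. -/
theorem ConnEuler.exists_sparse_subdigraph [Nonempty V] (h : ConnEuler A) :
    ∃ B ⊆ A, ConnEuler B ∧ ∃ T ⊆ B, (∀ a ∈ T, ∀ b ∈ T, a.2 = b.2 → a = b) ∧
      ∀ C ⊆ B \ T, C.Nonempty → ¬ ∀ v, outdeg C v = indeg C v := by
  obtain ⟨B, hB, hmin⟩ := (A.powerset.filter ConnEuler).exists_min_image Finset.card
    ⟨A, by simp [h]⟩
  simp only [Finset.mem_filter, Finset.mem_powerset] at hB hmin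
  obtain ⟨T, hTB, hT, hreach⟩ := hB.2.1.exists_arborescence (Classical.arbitrary V)
  refine ⟨B, hB.1, hB.2, T, hTB, hT, fun C hC hne hbal => ?_⟩
  have hCB : C ⊆ B := hC.trans Finset.sdiff_subset
  have hfilter : ∀ P : V × V → Prop, (B \ C).filter P = B.filter P \ C.filter P := fun P => by
    ext a
    simp only [Finset.mem_filter, Finset.mem_sdiff]
    tauto
  have hdiff : ∀ v, outdeg (B \ C) v = indeg (B \ C) v := by
    intro v
    have h1 := Finset.card_sdiff_add_card_eq_card
      (Finset.filter_subset_filter (fun a => a.1 = v) hCB)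
    have h2 := Finset.card_sdiff_add_card_eq_card
      (Finset.filter_subset_filter (fun a => a.2 = v) hCB)
    rw [← hfilter] at h1 h2
    have h3 := hB.2.2 v
    have h4 := hbal v
    simp only [outdeg, indeg] at h3 h4 ⊢
    omega
  have hconn : StrongConn (B \ C) := by
    refine strongConn_of_balanced hdiff (Classical.arbitrary V) fun v =>
      Relation.ReflTransGen.mono (fun x y hxy => ?_) _ _ (hreach v)
    exact Finset.mem_sdiff.2 ⟨hTB hxy, fun hc => (Finset.mem_sdiff.1 (hC hc)).2 hxy⟩
  have hle := hmin (B \ C) ⟨Finset.sdiff_subset.trans hB.1, hconn, hdiff⟩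
  have hlt := Finset.card_sdiff_add_card_eq_card hCB
  have := hne.card_pos
  omega

theorem exists_topological_order {F : Finset (V × V)}
    (hF : ∀ C ⊆ F, C.Nonempty → ¬ ∀ v, outdeg C v = indeg C v) :
    ∃ le : V → V → Prop, IsLinearOrder V le ∧ ∀ a ∈ F, le a.1 a.2 ∧ a.1 ≠ a.2 := by
  have hno : ∀ R : Finset V, R.Nonempty → ¬ ∀ x ∈ R, ∃ y ∈ R, (x, y) ∈ F := by
    intro R hR h
    obtain ⟨C, hC, hne, hbal⟩ := exists_balanced_subset hR h
    exact hF C hC hne hbal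
  set r : V → V → Prop := Relation.ReflTransGen fun x y => (x, y) ∈ F with hr
  have hanti : ∀ u v, r u v → r v u → u = v := by
    intro u v huv hvu
    by_contra hne
    refine hno (Finset.univ.filter fun x => r u x ∧ r x u)
      ⟨u, by simp [hr, Relation.ReflTransGen.refl]⟩ ?_
    intro x hx
    simp only [Finset.mem_filter, Finset.mem_univ, true_and] at hx ⊢
    obtain ⟨z, hzx, hxz, hzu⟩ : ∃ z, x ≠ z ∧ r x z ∧ r z u := by
      by_cases hxu : x = u
      · exact ⟨v, hxu ▸ hne, hxu ▸ huv, hvu⟩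
      · exact ⟨u, hxu, hx.2, .refl⟩
    rcases hxz.cases_head with h | ⟨y, hxy, hyz⟩
    · exact absurd h hzx
    · exact ⟨y, ⟨hx.1.tail hxy, hyz.trans hzu⟩, hxy⟩
  have : IsPartialOrder V r :=
    { refl := fun _ => .refl
      trans := fun _ _ _ => .trans
      antisymm := hanti }
  obtain ⟨le, hle, hrle⟩ := extend_partialOrder r
  refine ⟨le, hle, fun a ha => ⟨hrle _ _ (.single ha), fun heq => ?_⟩⟩
  exact hno {a.1} (Finset.singleton_nonempty _) fun x hx =>
    ⟨x, hx, by rw [Finset.mem_singleton.1 hx]; nth_rw 2 [heq]; exact ha⟩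

/-- The total length of the arcs outside `T`, measured by the potential `f`, is at most
`s * |T|`. -/
theorem sum_potential_le {B T : Finset (V × V)} (hB : ∀ v, outdeg B v = indeg B v)
    (hT : T ⊆ B) {f : V → ℕ} {s : ℕ} (hf : ∀ v, f v ≤ s)
    (hmono : ∀ a ∈ B \ T, f a.1 ≤ f a.2) :
    ∑ a ∈ B \ T, (f a.2 - f a.1) ≤ s * T.card := by
  have h0 := sum_arcs_eq_of_balanced hB (fun v => (f v : ℤ))
  rw [← Finset.sum_sdiff hT, ← Finset.sum_sdiff hT] at h0
  have h1 : ∑ a ∈ T, (f a.1 : ℤ) ≤ T.card • (s : ℤ) :=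
    Finset.sum_le_card_nsmul _ _ _ fun a _ => by exact_mod_cast hf a.1
  have h2 : (0 : ℤ) ≤ ∑ a ∈ T, (f a.2 : ℤ) := Finset.sum_nonneg fun a _ => by positivity
  have h3 : ((∑ a ∈ B \ T, (f a.2 - f a.1) : ℕ) : ℤ) =
      ∑ a ∈ B \ T, (f a.2 : ℤ) - ∑ a ∈ B \ T, (f a.1 : ℤ) := by
    rw [← Finset.sum_sub_distrib]
    push_cast
    exact Finset.sum_congr rfl fun a ha => by rw [Nat.cast_sub (hmono a ha)]
  zify
  rw [nsmul_eq_mul] at h1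
  push_cast at h3
  linarith

theorem card_arcs_inside_le {B T : Finset (V × V)} (hB : ∀ v, outdeg B v = indeg B v)
    (hTB : T ⊆ B) (hT : ∀ a ∈ T, ∀ b ∈ T, a.2 = b.2 → a = b)
    (hF : ∀ C ⊆ B \ T, C.Nonempty → ¬ ∀ v, outdeg C v = indeg C v)
    {t : ℕ} (ht : 0 < t) (hcard : Fintype.card V ≤ t * t) (S : Finset V) :
    (B.filter fun a => a.1 ∈ S ∧ a.2 ∈ S).card ≤ S.card * (2 * t + 1) := by
  obtain ⟨le, hle, hFle⟩ := exists_topological_order hF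
  set f : V → ℕ := fun v => (S.filter fun x => le x v ∧ x ≠ v).card with hf
  have hmono : ∀ {u v}, le u v → u ≠ v →
      (S.filter fun x => le x u ∧ x ≠ u) ⊆ S.filter fun x => le x v ∧ x ≠ v := by
    intro u v huv hne x hx
    simp only [Finset.mem_filter] at hx ⊢
    refine ⟨hx.1, hle.trans _ _ _ hx.2.1 huv, ?_⟩
    rintro rfl
    exact hne (hle.antisymm _ _ huv hx.2.1)
  have hlt : ∀ {u v}, u ∈ S → le u v → u ≠ v → f u < f v := by
    intro u v hu huv hne
    refine Finset.card_lt_card ⟨hmono huv hne, fun hsub => ?_⟩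
    have := hsub (Finset.mem_filter.2 ⟨hu, huv, hne⟩)
    simp at this
  have hinj : ∀ u ∈ S, ∀ v ∈ S, f u = f v → u = v := by
    intro u hu v hv huv
    by_contra hne
    rcases hle.total u v with h | h
    · exact (hlt hu h hne).ne huv
    · exact (hlt hv h (Ne.symm hne)).ne' huv
  have hTcard : T.card ≤ Fintype.card V :=
    Finset.card_le_card_of_injOn (fun a => a.2) (fun a _ => Finset.mem_univ _)
      fun a ha b hb => hT a ha b hb
  have htotal := sum_potential_le hB hTB (f := f) (fun v => Finset.card_filter_le S _)
    (fun a ha => Finset.card_le_card (hmono (hFle a ha).1 (hFle a ha).2))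
  set FS := (B \ T).filter fun a => a.1 ∈ S ∧ a.2 ∈ S with hFS
  have hlong : (FS.filter fun a => t ≤ f a.2 - f a.1).card ≤ S.card * t := by
    have h1 : (FS.filter fun a => t ≤ f a.2 - f a.1).card • t ≤
        ∑ a ∈ FS.filter (fun a => t ≤ f a.2 - f a.1), (f a.2 - f a.1) :=
      Finset.card_nsmul_le_sum _ _ _ fun a ha => (Finset.mem_filter.1 ha).2
    have h2 : ∑ a ∈ FS.filter (fun a => t ≤ f a.2 - f a.1), (f a.2 - f a.1) ≤
        ∑ a ∈ B \ T, (f a.2 - f a.1) :=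
      Finset.sum_le_sum_of_subset
        ((Finset.filter_subset _ _).trans (Finset.filter_subset _ _))
    have h3 : S.card * T.card ≤ S.card * (t * t) :=
      Nat.mul_le_mul_left _ (hTcard.trans hcard)
    refine Nat.le_of_mul_le_mul_right ?_ ht
    rw [smul_eq_mul] at h1
    calc _ ≤ _ := h1
      _ ≤ _ := h2
      _ ≤ _ := htotal
      _ ≤ _ := h3
      _ = _ := by ring
  have hshort : (FS.filter fun a => ¬ t ≤ f a.2 - f a.1).card ≤ S.card * t := by
    rw [← Finset.card_range t, ← Finset.card_product, Finset.card_range]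
    refine Finset.card_le_card_of_injOn (fun a => (a.1, f a.2 - f a.1)) ?_ ?_
    · intro a ha
      simp only [hFS, Finset.coe_filter, Finset.mem_filter, Set.mem_ofPred_eq] at ha
      simp only [Finset.coe_product, Set.mem_prod, Finset.mem_coe, Finset.mem_range]
      exact ⟨ha.1.2.1, not_le.1 ha.2⟩
    · intro a ha b hb hab
      simp only [hFS, Finset.coe_filter, Finset.mem_filter, Set.mem_ofPred_eq] at ha hb
      simp only [Prod.mk.injEq] at hab
      have h1 := hlt ha.1.2.1 (hFle a ha.1.1).1 (hFle a ha.1.1).2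
      have h2 := hlt hb.1.2.1 (hFle b hb.1.1).1 (hFle b hb.1.1).2
      have h3 := congrArg f hab.1
      exact Prod.ext hab.1 (hinj _ ha.1.2.2 _ hb.1.2.2 (by omega))
  have htree : (T.filter fun a => a.1 ∈ S ∧ a.2 ∈ S).card ≤ S.card :=
    Finset.card_le_card_of_injOn (fun a => a.2) (fun a ha => by simp_all)
      fun a ha b hb => hT a (by simp_all) b (by simp_all)
  have hsplit := Finset.card_filter_add_card_filter_not (s := FS) (fun a => t ≤ f a.2 - f a.1)
  have hunion : (B.filter fun a => a.1 ∈ S ∧ a.2 ∈ S).card ≤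
      FS.card + (T.filter fun a => a.1 ∈ S ∧ a.2 ∈ S).card := by
    refine (Finset.card_le_card ?_).trans (Finset.card_union_le _ _)
    rw [hFS, ← Finset.filter_union, Finset.sdiff_union_of_subset hTB]
  calc _ ≤ _ := hunion
    _ ≤ S.card * t + S.card * t + S.card := by omega
    _ = _ := by ring

end Density

section Hamiltonian

variable {A : Finset (V × V)} {w : ℕ → V} {m : ℕ}

/-- By Hall's theorem, every block of `D + 1` consecutive positions of a spanning trail contains
the position chosen for some vertex, if each vertex set `S` spans at most `D * |S|` arcs. -/
theorem IsTrail.exists_positions {D : ℕ} (hD : 0 < D) (hw : IsTrail A w m)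
    (hvisit : ∀ v, ∃ i < m, w i = v)
    (hdens : ∀ S : Finset V, (A.filter fun a => a.1 ∈ S ∧ a.2 ∈ S).card ≤ S.card * D) :
    ∃ pos : V → ℕ, (∀ v, pos v < m ∧ w (pos v) = v) ∧
      ∀ i, (i + 1) * (D + 1) ≤ m → ∃ v, i * (D + 1) ≤ pos v ∧ pos v < (i + 1) * (D + 1) := by
  have hblock : ∀ i : Fin (m / (D + 1)), (i.1 + 1) * (D + 1) ≤ m := fun i =>
    (Nat.mul_le_mul_right _ i.2).trans (Nat.div_mul_le_self _ _)
  have hhall : ∀ I : Finset (Fin (m / (D + 1))), I.card ≤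
      (I.biUnion fun i => (Finset.range (D + 1)).image fun j => w (i.1 * (D + 1) + j)).card := by
    intro I
    set S := I.biUnion fun i => (Finset.range (D + 1)).image fun j => w (i.1 * (D + 1) + j)
      with hS
    have hmem : ∀ i ∈ I, ∀ j < D + 1, w (i.1 * (D + 1) + j) ∈ S := fun i hi j hj =>
      Finset.mem_biUnion.2 ⟨i, hi, Finset.mem_image_of_mem _ (Finset.mem_range.2 hj)⟩
    refine Nat.le_of_mul_le_mul_right (le_trans ?_ (hdens S)) hD
    have hprod : I.card * D = (I ×ˢ Finset.range D).card := by
      rw [Finset.card_product, Finset.card_range]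
    rw [hprod]
    have hlt : ∀ p ∈ I ×ˢ Finset.range D, p.1.1 * (D + 1) + p.2 + 1 < m := by
      intro p hp
      have h1 := hblock p.1
      have h2 := Finset.mem_range.1 (Finset.mem_product.1 hp).2
      rw [add_mul] at h1
      omega
    refine Finset.card_le_card_of_injOn
      (fun p => (w (p.1.1 * (D + 1) + p.2), w (p.1.1 * (D + 1) + p.2 + 1))) ?_ ?_
    · intro p hp
      obtain ⟨h1, h2⟩ := Finset.mem_product.1 hp
      have h2 := Finset.mem_range.1 h2
      refine Finset.mem_filter.2 ⟨hw.1 _ (by have := hlt p hp; omega), ?_, ?_⟩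
      · exact hmem _ h1 p.2 (by omega)
      · exact hmem _ h1 (p.2 + 1) (by omega)
    · intro p hp q hq hpq
      simp only [Prod.mk.injEq] at hpq
      have hpos := hw.2 _ (by have := hlt p hp; omega) _ (by have := hlt q hq; omega) hpq.1 hpq.2
      have hp2 := Finset.mem_range.1 (Finset.mem_product.1 hp).2
      have hq2 := Finset.mem_range.1 (Finset.mem_product.1 hq).2
      have hdiv : ∀ a b, b < D → (a * (D + 1) + b) / (D + 1) = a := fun a b hb => by
        rw [add_comm, Nat.add_mul_div_right _ _ (by omega), Nat.div_eq_of_lt (by omega), zero_add]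
      have h1 : p.1.1 = q.1.1 := by rw [← hdiv p.1.1 p.2 hp2, hpos, hdiv _ _ hq2]
      rw [h1] at hpos
      exact Prod.ext (Fin.ext h1) (by omega)
  obtain ⟨ρ, hρ, hρmem⟩ := (Finset.all_card_le_biUnion_card_iff_exists_injective _).1 hhall
  simp only [Finset.mem_image, Finset.mem_range] at hρmem
  choose j hj hwj using hρmem
  choose vis hvis hwvis using hvisit
  refine ⟨fun v => if h : ∃ i, ρ i = v then h.choose.1 * (D + 1) + j h.choose else vis v,
    fun v => ?_, fun i hi => ?_⟩
  · dsimp only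
    split_ifs with h
    · have h1 := hblock h.choose
      have h2 := hj h.choose
      rw [add_mul] at h1
      exact ⟨by omega, (hwj _).trans h.choose_spec⟩
    · exact ⟨hvis v, hwvis v⟩
  · have hq : i < m / (D + 1) := (Nat.le_div_iff_mul_le (by omega)).2 hi
    have hex : ∃ i', ρ i' = ρ ⟨i, hq⟩ := ⟨_, rfl⟩
    have heq : hex.choose = ⟨i, hq⟩ := hρ hex.choose_spec
    refine ⟨ρ ⟨i, hq⟩, ?_⟩
    beta_reduce
    rw [dif_pos hex, heq]
    have := hj ⟨i, hq⟩
    rw [add_mul]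
    dsimp only
    exact ⟨by omega, by omega⟩

theorem exists_enumeration (P : Finset ℕ) :
    ∃ e : ℕ → ℕ, (∀ i < P.card, ∀ j < P.card, e i < e j ↔ i < j) ∧ (∀ i < P.card, e i ∈ P) ∧
      ∀ p ∈ P, ∃ i < P.card, e i = p := by
  refine ⟨fun i => if h : i < P.card then P.orderEmbOfFin rfl ⟨i, h⟩ else 0, ?_, ?_, ?_⟩
  · intro i hi j hj
    simp [hi, hj]
  · intro i hi
    simp [hi]
  · intro p hp
    rw [← Finset.mem_coe, ← Finset.range_orderEmbOfFin P rfl] at hp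
    obtain ⟨i, rfl⟩ := hp
    exact ⟨i.1, i.2, by simp⟩

/-- If the positions chosen on a closed walk meet every block of length `L`, then traversing the
vertices in the order of their positions is a Hamiltonian cycle of the power. -/
theorem isHamiltonian_of_positions [Fintype V] (hV : 1 < Fintype.card V) (hw : IsWalk A w m)
    (hclosed : w m = w 0) {pos : V → ℕ} (hpos : ∀ v, pos v < m ∧ w (pos v) = v) {L k : ℕ}
    (hL : 0 < L) (hblock : ∀ i, (i + 1) * L ≤ m → ∃ v, i * L ≤ pos v ∧ pos v < (i + 1) * L)
    (hk : 3 * L ≤ k + 1) : IsHamiltonian (powRel A k) := by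
  have hinj : Function.Injective pos := fun u v huv => by rw [← (hpos u).2, huv, (hpos v).2]
  have hgap : ∀ a b, a < b → b ≤ m → (∀ v, ¬ (a < pos v ∧ pos v < b)) → b < a + 2 * L := by
    intro a b hab hb hno
    by_contra hle
    have h1 : a < (a / L + 1) * L := by
      rw [mul_comm]
      exact Nat.lt_mul_div_succ a hL
    have h2 : (a / L + 1 + 1) * L ≤ b := by
      have := Nat.div_mul_le_self a L
      rw [add_mul, add_mul]
      omega
    obtain ⟨v, hv1, hv2⟩ := hblock (a / L + 1) (h2.trans hb)
    exact hno v ⟨by omega, by omega⟩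
  obtain ⟨e, hlt, hmem, hsurj⟩ := exists_enumeration (Finset.univ.image pos)
  rw [Finset.card_image_of_injective _ hinj, Finset.card_univ] at hlt hmem hsurj
  have hmem' : ∀ i < Fintype.card V, ∃ v, pos v = e i := fun i hi => by
    simpa using hmem i hi
  have hsurj' : ∀ v, ∃ i < Fintype.card V, e i = pos v := fun v => hsurj _ (by simp)
  have hwe : ∀ i < Fintype.card V, ∀ j < Fintype.card V, w (e i) = w (e j) → i = j := by
    intro i hi j hj hij
    obtain ⟨u, hu⟩ := hmem' i hi
    obtain ⟨v, hv⟩ := hmem' j hj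
    rw [← hu, ← hv, (hpos u).2, (hpos v).2] at hij
    subst hij
    have h1 := hlt i hi j hj
    have h2 := hlt j hj i hi
    omega
  have hem : ∀ i < Fintype.card V, e i < m := fun i hi => by
    obtain ⟨v, hv⟩ := hmem' i hi
    exact hv ▸ (hpos v).1
  obtain ⟨n, hn⟩ : ∃ n, Fintype.card V = n + 1 := ⟨Fintype.card V - 1, by omega⟩
  rw [hn] at hlt hmem' hsurj' hwe hem hV
  have hstep : ∀ i < n, powRel A k (w (e i)) (w (e (i + 1))) := by
    intro i hi
    have h1 := (hlt i (by omega) (i + 1) (by omega)).2 (by omega)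
    have h2 := hem (i + 1) (by omega)
    have h3 := hgap (e i) (e (i + 1)) h1 h2.le (by
      rintro v ⟨hv1, hv2⟩
      obtain ⟨x, hx, hxv⟩ := hsurj' v
      rw [← hxv] at hv1 hv2
      have := (hlt i (by omega) x hx).1 hv1
      have := (hlt x hx (i + 1) (by omega)).1 hv2
      omega)
    have hwalk : IsWalk A (fun x => w (e i + x)) (e (i + 1) - e i) := fun x hx =>
      hw (e i + x) (by omega)
    have hne : w (e i) ≠ w (e (i + 1)) := fun h => by
      have := hwe i (by omega) (i + 1) (by omega) h
      omega
    have := hwalk.powRel (k := k) (by omega)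
    simp only [add_zero, Nat.add_sub_cancel' h1.le] at this
    exact this hne
  have hwrap : powRel A k (w (e n)) (w (e 0)) := by
    have h0 := hem 0 (by omega)
    have h1 := hem n (by omega)
    have h2 := hgap (e n) m h1 le_rfl (by
      rintro v ⟨hv1, -⟩
      obtain ⟨x, hx, hxv⟩ := hsurj' v
      rw [← hxv] at hv1
      have := (hlt n (by omega) x hx).1 hv1
      omega)
    have h3 : e 0 < L := by
      rcases Nat.lt_or_ge m L with h | h
      · omega
      · obtain ⟨v, -, hv⟩ := hblock 0 (by omega)
        obtain ⟨x, hx, hxv⟩ := hsurj' v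
        have := hlt x hx 0 (by omega)
        omega
    have hwalk : IsWalk A (fun x => if x < m - e n then w (e n + x) else w (x - (m - e n)))
        (m - e n + e 0) := by
      intro x hx
      rcases lt_trichotomy (x + 1) (m - e n) with h | h | h
      · simpa [h, show x < m - e n by omega, add_assoc] using hw (e n + x) (by omega)
      · have := hw (e n + x) (by omega)
        rw [show e n + x + 1 = m by omega, hclosed] at this
        simpa [h, show x < m - e n by omega] using this
      · have := hw (x - (m - e n)) (by omega)
        simpa [show ¬ x + 1 < m - e n by omega, show ¬ x < m - e n by omega,
          show x + 1 - (m - e n) = x - (m - e n) + 1 by omega] using this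
    have hne : w (e n) ≠ w (e 0) := fun h => by
      have := hwe n (by omega) 0 (by omega) h
      omega
    have := hwalk.powRel (k := k) (by omega)
    simp only [show 0 < m - e n by omega, if_true, add_zero,
      show ¬ m - e n + e 0 < m - e n by omega, if_false, Nat.add_sub_cancel_left] at this
    exact this hne
  refine ⟨(List.range (n + 1)).map fun i => w (e i), ?_, fun v => ?_,
    by simpa using Nat.succ_le_of_lt hV, ?_⟩
  · refine List.Nodup.map_on (fun i hi j hj => ?_) List.nodup_range
    exact hwe i (List.mem_range.1 hi) j (List.mem_range.1 hj)
  · obtain ⟨i, hi, hiv⟩ := hsurj' v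
    exact List.mem_map.2 ⟨i, List.mem_range.2 hi, by rw [hiv, (hpos v).2]⟩
  · refine List.isChain_append.2 ⟨?_, ?_, ?_⟩
    · rw [List.isChain_map, List.isChain_range_succ]
      exact hstep
    · simp [List.range_succ_eq_map]
    · intro x hx y hy
      have hx' : w (e n) = x := by simpa [List.range_succ] using hx
      have hy' : w (e 0) = y := by simpa [List.range_succ_eq_map] using hy
      rw [← hx', ← hy']
      exact hwrap

theorem isHamiltonian_of_forall_ne [Fintype V] (hV : 1 < Fintype.card V) {R : V → V → Prop}
    (hR : ∀ u v, u ≠ v → R u v) : IsHamiltonian R := by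
  have hcard : Finset.univ.toList.length = Fintype.card V := Finset.length_toList _
  have hnd : (Finset.univ : Finset V).toList.Nodup := Finset.nodup_toList _
  refine ⟨Finset.univ.toList, hnd, by simp, by omega, ?_⟩
  revert hcard hnd
  generalize (Finset.univ : Finset V).toList = l
  intro hcard hnd
  rcases l with _ | ⟨a, _ | ⟨b, l⟩⟩
  · simp at hcard; omega
  · simp at hcard; omega
  · refine List.isChain_append.2 ⟨?_, by simp, ?_⟩
    · exact (List.Pairwise.imp (fun h => hR _ _ h) hnd).isChain
    · intro x hx y hy
      obtain rfl : a = y := by simpa using hy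
      refine hR _ _ ?_
      rintro rfl
      have : x ∈ b :: l := List.mem_of_getLast? (by simpa using hx)
      exact (List.nodup_cons.1 hnd).1 this

/-- A connected Eulerian digraph on `n` vertices has a Hamiltonian `O(√n)`-th power. -/
theorem ConnEuler.isHamiltonian_powRel [Fintype V] (hV : 1 < Fintype.card V) (h : ConnEuler A)
    {k : ℕ} (hk : 6 * Nat.sqrt (Fintype.card V) + 11 ≤ k) : IsHamiltonian (powRel A k) := by
  have : Nonempty V := Fintype.card_pos_iff.1 (by omega)
  obtain ⟨B, hBA, hB, T, hTB, hT, hF⟩ := h.exists_sparse_subdigraph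
  obtain ⟨w, m, hw, hclosed, hvisit⟩ := hB.exists_closed_trail hV
  set t := Nat.sqrt (Fintype.card V) + 1 with ht
  have hcard : Fintype.card V ≤ t * t := (Nat.lt_succ_sqrt _).le
  obtain ⟨pos, hpos, hblock⟩ := hw.exists_positions (D := 2 * t + 1) (by omega) hvisit
    (card_arcs_inside_le hB.2 hTB hT hF (by omega) hcard)
  exact isHamiltonian_of_positions hV (fun i hi => hBA (hw.1 i hi)) hclosed hpos (by omega) hblock
    (by omega)

end Hamiltonian

section Numerics

open Real

theorem le_ceil_of_lt_thirty_two {n : ℕ} (h2 : 2 ≤ n) (h32 : n < 32) :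
    n ≤ ⌈√(n : ℝ) * (logb 2 (n : ℝ)) ^ 2 / 2⌉₊ + 1 := by
  have hn : (2 : ℝ) ≤ n := by exact_mod_cast h2
  suffices H : (n : ℝ) - 2 < √(n : ℝ) * (logb 2 (n : ℝ)) ^ 2 / 2 by
    have h3 : ((n - 2 : ℕ) : ℝ) < √(n : ℝ) * (logb 2 (n : ℝ)) ^ 2 / 2 := by
      rw [Nat.cast_sub h2]
      exact_mod_cast H
    have := Nat.lt_ceil.2 h3
    omega
  have hsqrt : √(n : ℝ) * √(n : ℝ) = n := mul_self_sqrt (by linarith)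
  have hbound : ∀ c : ℝ, 0 ≤ c → c ≤ logb 2 n → (n - 2 : ℝ) < √(n : ℝ) * c ^ 2 / 2 →
      (n : ℝ) - 2 < √(n : ℝ) * (logb 2 (n : ℝ)) ^ 2 / 2 := by
    intro c hc hcl hlt
    refine hlt.trans_le ?_
    gcongr
  have hpow : ∀ j : ℕ, 2 ^ j ≤ n → (j : ℝ) ≤ logb 2 n := by
    intro j hj
    rw [le_logb_iff_rpow_le (by norm_num) (by linarith), rpow_natCast]
    exact_mod_cast hj
  have hlt32 : (n : ℝ) < 32 := by exact_mod_cast h32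
  have hs0 : 0 ≤ √(n : ℝ) := sqrt_nonneg _
  rcases Nat.lt_or_ge n 4 with h4 | h4
  · rcases (by omega : n = 2 ∨ n = 3) with rfl | rfl
    · refine hbound 1 zero_le_one (by simp) ?_
      norm_num
    · refine hbound (3 / 2) (by norm_num) ?_ ?_
      · rw [le_logb_iff_rpow_le (by norm_num) (by norm_num)]
        refine (pow_le_pow_iff_left₀ (by positivity) (by norm_num) two_ne_zero).1 ?_
        rw [← rpow_natCast, ← rpow_mul (by norm_num)]
        norm_num
      · push_cast at hsqrt hs0 ⊢
        nlinarith
  rcases Nat.lt_or_ge n 8 with h8 | h8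
  · refine hbound 2 (by norm_num) (by simpa using hpow 2 h4) ?_
    have : (n : ℝ) ≤ 7 := by exact_mod_cast Nat.lt_succ_iff.1 h8
    have : (4 : ℝ) ≤ n := by exact_mod_cast h4
    nlinarith
  rcases Nat.lt_or_ge n 16 with h16 | h16
  · refine hbound 3 (by norm_num) (by simpa using hpow 3 h8) ?_
    have : (n : ℝ) ≤ 15 := by exact_mod_cast Nat.lt_succ_iff.1 h16
    have : (8 : ℝ) ≤ n := by exact_mod_cast h8
    nlinarith
  · refine hbound 4 (by norm_num) (by simpa using hpow 4 h16) ?_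
    nlinarith

theorem sqrt_bound_le_ceil {n : ℕ} (h : 32 ≤ n) :
    6 * Nat.sqrt n + 11 ≤ ⌈√(n : ℝ) * (logb 2 (n : ℝ)) ^ 2 / 2⌉₊ := by
  have hn : (32 : ℝ) ≤ n := by exact_mod_cast h
  have hlog : 5 ≤ logb 2 (n : ℝ) := by
    rw [le_logb_iff_rpow_le (by norm_num) (by linarith)]
    norm_num
    exact h
  have hsqrt : 5 ≤ √(n : ℝ) := le_sqrt_of_sq_le (by linarith)
  have hnat : (Nat.sqrt n : ℝ) ≤ √(n : ℝ) := nat_sqrt_le_real_sqrt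
  have hsq : (25 : ℝ) ≤ (logb 2 (n : ℝ)) ^ 2 := by nlinarith
  have : ((6 * Nat.sqrt n + 11 : ℕ) : ℝ) ≤ (⌈√(n : ℝ) * (logb 2 (n : ℝ)) ^ 2 / 2⌉₊ : ℕ) := by
    refine le_trans ?_ (Nat.le_ceil _)
    push_cast
    nlinarith
  exact_mod_cast this

end Numerics

/-- The `⌈(1/2)√n log₂² n⌉`-th power of any `n`-vertex connected
Eulerian digraph (`n > 1`) is Hamiltonian. -/
theorem stmt12 [Fintype V] (A : Finset (V × V)) (hA : Loopless A)
    (hn : 1 < Fintype.card V) (h : ConnEuler A) :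
    IsHamiltonian (powRel A
      ⌈Real.sqrt (Fintype.card V) * (Real.logb 2 (Fintype.card V)) ^ 2 / 2⌉₊) := by
  rcases Nat.lt_or_ge (Fintype.card V) 32 with h32 | h32
  · exact isHamiltonian_of_forall_ne hn fun u v huv =>
      powRel_of_card_le h.1 (le_ceil_of_lt_thirty_two hn h32) huv
  · exact h.isHamiltonian_powRel hn (sqrt_bound_le_ceil h32)
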